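/- arXiv:2202.13550 — 3 statements merged into one kernel-verified Lean document; each statement's English description precedes it below -/
import Mathlib

section
/- Let f ∈ K[z] be a nonconstant polynomial and let c ∈ K be a critical point of f, i.e. f'(c) = 0. Let m be the multiplicity of c as a root of the polynomial f − f(c) (in Lean: (f - C (f.eval c)).rootMultiplicity c). Then m ≥ 2, the Taylor coefficient C₀ := ‖(Polynomial.taylor c f).coeff m‖ is strictly positive, and there exists ε with 0 < ε < 1 such that for every r with 0 < r ≤ ε one has f(D̄(c,r)) = D̄(f(c), C₀ · r^m). -/
open Polynomial Metric

/-- If all roots of a product of linear factors lie outside the closed disk of radius `r`, then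
on that disk the constant term strictly dominates every other monomial. -/
lemma norm_coeff_prod_X_sub_C_mul_pow_lt {K : Type*} [NormedField K] [IsUltrametricDist K]
    {r : ℝ} (hr : 0 < r) (s : Multiset K) (hs : ∀ a ∈ s, r < ‖a‖) :
    0 < ‖((s.map fun a => X - C a).prod).coeff 0‖ ∧
      ∀ k, ‖((s.map fun a => X - C a).prod).coeff (k + 1)‖ * r ^ (k + 1) <
        ‖((s.map fun a => X - C a).prod).coeff 0‖ := by
  induction s using Multiset.induction_on with
  | empty => simp [coeff_one]
  | cons a s ih =>
    obtain ⟨h0, h1⟩ := ih fun b hb => hs b (Multiset.mem_cons_of_mem hb)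
    have ha : r < ‖a‖ := hs a (Multiset.mem_cons_self a s)
    have ha0 : 0 < ‖a‖ := hr.trans ha
    rw [Multiset.map_cons, Multiset.prod_cons]
    set Q := (s.map fun a => X - C a).prod
    have hc0 : ‖((X - C a) * Q).coeff 0‖ = ‖a‖ * ‖Q.coeff 0‖ := by
      simp [mul_coeff_zero]
    refine ⟨hc0 ▸ mul_pos ha0 h0, fun k => ?_⟩
    have hck : ((X - C a) * Q).coeff (k + 1) = Q.coeff k - a * Q.coeff (k + 1) := by
      simp [sub_mul]
    have hle : ‖Q.coeff k‖ * r ^ k ≤ ‖Q.coeff 0‖ := by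
      cases k with
      | zero => simp
      | succ k => exact (h1 k).le
    have hleft : ‖Q.coeff k‖ * r ^ (k + 1) < ‖a‖ * ‖Q.coeff 0‖ :=
      calc ‖Q.coeff k‖ * r ^ (k + 1) = r * (‖Q.coeff k‖ * r ^ k) := by ring
        _ ≤ r * ‖Q.coeff 0‖ := by gcongr
        _ < ‖a‖ * ‖Q.coeff 0‖ := by gcongr
    have hright : ‖a * Q.coeff (k + 1)‖ * r ^ (k + 1) < ‖a‖ * ‖Q.coeff 0‖ := by
      rw [norm_mul, mul_assoc]
      exact mul_lt_mul_of_pos_left (h1 k) ha0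
    rw [hc0, hck]
    have hmax : ‖Q.coeff k - a * Q.coeff (k + 1)‖ ≤ max ‖Q.coeff k‖ ‖a * Q.coeff (k + 1)‖ := by
      simpa [sub_eq_add_neg] using
        IsUltrametricDist.norm_add_le_max (Q.coeff k) (-(a * Q.coeff (k + 1)))
    rcases le_max_iff.mp hmax with h | h
    · exact (mul_le_mul_of_nonneg_right h (by positivity)).trans_lt hleft
    · exact (mul_le_mul_of_nonneg_right h (by positivity)).trans_lt hright

/-- Over an algebraically closed ultrametric field, a polynomial whose constant term does not
dominate some other monomial on the closed disk of radius `r` has a root in that disk. -/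
lemma exists_root_norm_le_of_norm_coeff_zero_le {K : Type*} [NormedField K]
    [IsUltrametricDist K] [IsAlgClosed K] {r : ℝ} (hr : 0 < r) {p : K[X]} (hp : p ≠ 0)
    {k : ℕ} (hk : k ≠ 0) (h : ‖p.coeff 0‖ ≤ ‖p.coeff k‖ * r ^ k) :
    ∃ z, ‖z‖ ≤ r ∧ p.eval z = 0 := by
  by_contra! hroot
  have hs : ∀ a ∈ p.roots, r < ‖a‖ := fun a ha => by
    by_contra! hle
    exact hroot a hle (isRoot_of_mem_roots ha)
  obtain ⟨k, rfl⟩ := Nat.exists_eq_succ_of_ne_zero hk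
  have hlt := (norm_coeff_prod_X_sub_C_mul_pow_lt hr p.roots hs).2 k
  have hprod := (IsAlgClosed.splits p).eq_prod_roots
  have hlead : 0 < ‖p.leadingCoeff‖ := norm_pos_iff.mpr (leadingCoeff_ne_zero.mpr hp)
  have hcoeff (n : ℕ) : ‖p.coeff n‖ =
      ‖p.leadingCoeff‖ * ‖((p.roots.map fun a => X - C a).prod).coeff n‖ := by
    conv_lhs => rw [hprod]
    rw [coeff_C_mul, norm_mul]
  rw [hcoeff, hcoeff, mul_assoc] at h
  exact (mul_lt_mul_of_pos_left hlt hlead).not_ge h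

/-- Near a critical point `c` of a nonconstant polynomial `f` over an algebraically closed,
complete nonarchimedean field, with `m` the root multiplicity of `c` in `f - f(c)`, one has
`m ≥ 2`, the `m`-th Taylor coefficient of `f` at `c` is nonzero, and all small closed disks
around `c` are mapped onto closed disks of radius `C₀ · r^m`. -/
theorem image_closedBall_at_critical_point
    {K : Type*} [NontriviallyNormedField K] [IsUltrametricDist K]
    [IsAlgClosed K] [CharZero K] [CompleteSpace K]
    (f : Polynomial K) (hf : 0 < f.natDegree) (c : K)
    (hc : (Polynomial.derivative f).eval c = 0)
    (m : ℕ) (hm : m = (f - Polynomial.C (f.eval c)).rootMultiplicity c) :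
    2 ≤ m ∧ 0 < ‖(Polynomial.taylor c f).coeff m‖ ∧
      ∃ ε : ℝ, 0 < ε ∧ ε < 1 ∧
        ∀ r : ℝ, 0 < r → r ≤ ε →
          (fun z => f.eval z) '' closedBall c r =
            closedBall (f.eval c) (‖(Polynomial.taylor c f).coeff m‖ * r ^ m) := by
  have hsub (w : K) : f - C w ≠ 0 := fun h => by
    have := congrArg natDegree h
    rw [natDegree_sub_C, natDegree_zero] at this
    omega
  have hm2 : 2 ≤ m := by
    rw [hm]
    exact (one_lt_rootMultiplicity_iff_isRoot (hsub _)).mpr ⟨by simp, by simpa using hc⟩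
  obtain ⟨h, hfh, hdvd⟩ := exists_eq_pow_rootMultiplicity_mul_and_not_dvd _ (hsub (f.eval c)) c
  rw [← hm] at hfh
  have hhc : h.eval c ≠ 0 := fun h0 => hdvd (dvd_iff_isRoot.mpr h0)
  have hcoeff : (taylor c f).coeff m = h.eval c := by
    have hf' : f = (X - C c) ^ m * h + C (f.eval c) := by rw [← hfh]; ring
    rw [hf', map_add, taylor_mul, taylor_pow, map_sub, taylor_X, taylor_C, taylor_C,
      add_sub_cancel_right, coeff_add, coeff_C, if_neg (by omega), add_zero,
      coeff_X_pow_mul', if_pos le_rfl, Nat.sub_self, taylor_coeff_zero]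
  have heval (z : K) : f.eval z - f.eval c = (z - c) ^ m * h.eval z := by
    simpa using congrArg (eval z) hfh
  have hpos : 0 < ‖h.eval c‖ := norm_pos_iff.mpr hhc
  refine ⟨hm2, hcoeff ▸ hpos, ?_⟩
  obtain ⟨δ, hδ, hδh⟩ := Metric.continuousAt_iff.mp
    (h.continuous.continuousAt (x := c)) ‖h.eval c‖ hpos
  refine ⟨min (δ / 2) (1 / 2), by positivity, (min_le_right _ _).trans_lt (by norm_num),
    fun r hr hrε => ?_⟩
  rw [hcoeff]
  apply Set.Subset.antisymm
  · rintro _ ⟨z, hz, rfl⟩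
    have hzδ : dist z c < δ :=
      (mem_closedBall.mp hz).trans_lt ((hrε.trans (min_le_left _ _)).trans_lt (half_lt_self hδ))
    have hz' : ‖h.eval z‖ ≤ ‖h.eval c‖ := by
      have h1 := IsUltrametricDist.norm_add_le_max (h.eval z - h.eval c) (h.eval c)
      have h2 := hδh hzδ
      rw [dist_eq_norm] at h2
      rwa [sub_add_cancel, max_eq_right h2.le] at h1
    rw [mem_closedBall, dist_eq_norm] at hz ⊢
    simp only [heval, norm_mul, norm_pow]
    rw [mul_comm]
    gcongr
  · intro w hw
    rw [mem_closedBall, dist_eq_norm] at hw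
    have hc0 : (taylor c (f - C w)).coeff 0 = f.eval c - w := by
      rw [taylor_coeff_zero, eval_sub, eval_C]
    have hcm : (taylor c (f - C w)).coeff m = h.eval c := by
      rw [map_sub, taylor_C, coeff_sub, coeff_C, if_neg (by omega), sub_zero, hcoeff]
    obtain ⟨z, hz, hz0⟩ := exists_root_norm_le_of_norm_coeff_zero_le hr
      (p := taylor c (f - C w)) (mt (taylor_eq_zero c _).mp (hsub w)) (k := m) (by omega)
      (by rwa [hc0, hcm, norm_sub_rev])
    refine ⟨z + c, by simpa [dist_eq_norm] using hz, ?_⟩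
    rw [taylor_eval, eval_sub, eval_C] at hz0
    exact sub_eq_zero.mp hz0
end

section
/- Let f ∈ K[z] be a nonconstant polynomial, x₀ ∈ K, r > 0, and set s := sup_{z ∈ D̄(x₀,r)} ‖f(z) − f(x₀)‖. Let m be the number of solutions of f(z) = f(x₀) in D̄(x₀,r), counted with multiplicity. If ‖(m : K)‖ = 1 (the tame case: the residue characteristic does not divide the local degree m), then r · sup_{z ∈ D̄(x₀,r)} ‖f'(z)‖ = s; that is, the sup-norm of f' on the disk equals the ratio of the diameter of the image disk to the diameter of the disk. -/
open Polynomial Metric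
open scoped Classical

theorem IsUltrametricDist.norm_sub_le_max_norm {G : Type*} [SeminormedAddCommGroup G]
    [IsUltrametricDist G] (x y : G) : ‖x - y‖ ≤ max ‖x‖ ‖y‖ := by
  simpa [sub_eq_add_neg] using norm_add_le_max x (-y)

theorem IsUltrametricDist.norm_sub_eq_max_of_norm_ne_norm {G : Type*} [SeminormedAddCommGroup G]
    [IsUltrametricDist G] {x y : G} (h : ‖x‖ ≠ ‖y‖) : ‖x - y‖ = max ‖x‖ ‖y‖ := by
  rw [sub_eq_add_neg, norm_add_eq_max_of_norm_ne_norm (by rwa [norm_neg]), norm_neg]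

/-- The norms of an algebraically closed nontrivially normed field are dense in `(0, ∞)`. -/
theorem exists_norm_mem_Ioo_of_isAlgClosed (K : Type*) [NontriviallyNormedField K]
    [IsAlgClosed K] {a b : ℝ} (ha : 0 < a) (hab : a < b) : ∃ z : K, ‖z‖ ∈ Set.Ioo a b := by
  obtain ⟨x, hx⟩ := NormedField.exists_one_lt_norm K
  obtain ⟨n, hn⟩ := pow_unbounded_of_one_lt ‖x‖ ((one_lt_div ha).2 hab)
  have hn0 : n ≠ 0 := by
    rintro rfl
    rw [pow_zero] at hn
    linarith
  obtain ⟨y, hy⟩ := IsAlgClosed.exists_pow_nat_eq x (Nat.pos_of_ne_zero hn0)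
  have hyn : ‖y‖ ^ n = ‖x‖ := by rw [← norm_pow, hy]
  have hy1 : 1 < ‖y‖ := by
    rw [← hyn] at hx
    exact (one_lt_pow_iff_of_nonneg (norm_nonneg _) hn0).1 hx
  have hy2 : ‖y‖ < b / a := by
    rw [← hyn] at hn
    exact lt_of_pow_lt_pow_left₀ n (div_pos (ha.trans hab) ha).le hn
  obtain ⟨k, hk1, hk2⟩ := exists_mem_Ioc_zpow (ha.trans hab) hy1
  refine ⟨y ^ k, ?_, by rwa [norm_zpow]⟩
  rw [norm_zpow]
  have hpos : 0 < ‖y‖ ^ k := zpow_pos (by linarith) k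
  rw [zpow_add_one₀ (by linarith)] at hk2
  rw [lt_div_iff₀ ha] at hy2
  by_contra! h
  nlinarith [mul_le_mul_of_nonneg_right h (norm_nonneg y)]

/-- The Gauss norm on the disk of center `x₀` and radius `r` of a split polynomial with leading
coefficient `c` and multiset of roots `S`. -/
noncomputable def splitGaussNorm {K : Type*} [NormedField K] (x₀ : K) (r : ℝ) (c : K)
    (S : Multiset K) : ℝ :=
  ‖c‖ * (S.map fun a => max r ‖a - x₀‖).prod

/-- Taylor coefficients of a split polynomial are bounded by the Gauss norm, and the last index
at which the bound is attained is the number of roots in the closed disk. -/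
theorem taylor_coeff_splitGaussNorm {K : Type*} [NormedField K] [IsUltrametricDist K]
    (x₀ : K) {r : ℝ} (hr : 0 < r) {c : K} (hc : c ≠ 0) (S : Multiset K) :
    (∀ i, ‖(taylor x₀ (C c * (S.map fun a => X - C a).prod)).coeff i‖ * r ^ i
        ≤ splitGaussNorm x₀ r c S) ∧
    (∀ i, (S.filter (· ∈ closedBall x₀ r)).card < i →
      ‖(taylor x₀ (C c * (S.map fun a => X - C a).prod)).coeff i‖ * r ^ i
        < splitGaussNorm x₀ r c S) ∧
    ‖(taylor x₀ (C c * (S.map fun a => X - C a).prod)).coeff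
        (S.filter (· ∈ closedBall x₀ r)).card‖ * r ^ (S.filter (· ∈ closedBall x₀ r)).card
      = splitGaussNorm x₀ r c S := by
  induction S using Multiset.induction_on with
  | empty =>
    refine ⟨fun i => ?_, fun i hi => ?_, ?_⟩
    · rcases i with _ | i <;> simp [splitGaussNorm, coeff_C]
    · rcases i with _ | i
      · simp at hi
      · simpa [splitGaussNorm, coeff_C] using hc
    · simp [splitGaussNorm]
  | cons a S ih =>
    have hT : taylor x₀ (C c * ((a ::ₘ S).map fun a => X - C a).prod)
        = taylor x₀ (C c * (S.map fun a => X - C a).prod) * (X - C (a - x₀)) := by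
      rw [Multiset.map_cons, Multiset.prod_cons, mul_left_comm, taylor_mul, mul_comm]
      congr 1
      simp only [map_sub, taylor_X, taylor_C]
      ring
    have hM : splitGaussNorm x₀ r c (a ::ₘ S) = splitGaussNorm x₀ r c S * max r ‖a - x₀‖ := by
      simp only [splitGaussNorm, Multiset.map_cons, Multiset.prod_cons]
      ring
    rw [hT, hM]
    generalize taylor x₀ (C c * (S.map fun a => X - C a).prod) = p at ih ⊢
    set M := splitGaussNorm x₀ r c S
    have hMpos : 0 < M := by
      refine mul_pos (norm_pos_iff.2 hc) (Multiset.prod_pos ?_)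
      simp only [Multiset.mem_map]
      rintro _ ⟨b, -, rfl⟩
      exact lt_max_of_lt_left hr
    obtain ⟨h1, h2, h3⟩ := ih
    have e0 : (p * (X - C (a - x₀))).coeff 0 = -(p.coeff 0 * (a - x₀)) := by
      rw [mul_coeff_zero, coeff_sub, coeff_X_zero, coeff_C_zero, zero_sub, mul_neg]
    have e1 (i : ℕ) : (p * (X - C (a - x₀))).coeff (i + 1)
        = p.coeff i - p.coeff (i + 1) * (a - x₀) := by
      rw [mul_sub, coeff_sub, coeff_mul_X, coeff_mul_C]
    have hb : a ∈ closedBall x₀ r ↔ ‖a - x₀‖ ≤ r := by rw [mem_closedBall, dist_eq_norm]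
    generalize a - x₀ = b at *
    set R := max r ‖b‖
    have hRpos : 0 < R := lt_max_of_lt_left hr
    have hrR : r ≤ R := le_max_left _ _
    have hbR : ‖b‖ ≤ R := le_max_right _ _
    have t1 (i : ℕ) : ‖p.coeff i‖ * r ^ (i + 1) = ‖p.coeff i‖ * r ^ i * r := by ring
    have t2 (i : ℕ) : ‖p.coeff i * b‖ * r ^ i = ‖p.coeff i‖ * r ^ i * ‖b‖ := by
      rw [norm_mul]
      ring
    have hmax (u v : K) (i : ℕ) :
        ‖u - v‖ * r ^ i ≤ max (‖u‖ * r ^ i) (‖v‖ * r ^ i) := by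
      rw [← max_mul_of_nonneg _ _ (by positivity)]
      exact mul_le_mul_of_nonneg_right (IsUltrametricDist.norm_sub_le_max_norm u v) (by positivity)
    have bd {x y : ℝ} (hx : x ≤ M) (hy : 0 ≤ y) (hyR : y ≤ R) : x * y ≤ M * R :=
      mul_le_mul hx hyR hy hMpos.le
    have upper : ∀ i, ‖(p * (X - C b)).coeff i‖ * r ^ i ≤ M * R := by
      rintro (_ | i)
      · rw [e0, norm_neg, t2]
        exact bd (h1 0) (norm_nonneg _) hbR
      · rw [e1]
        refine (hmax _ _ _).trans (max_le ?_ ?_)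
        · rw [t1]
          exact bd (h1 i) hr.le hrR
        · rw [t2]
          exact bd (h1 _) (norm_nonneg _) hbR
    have eq_of_lt {u v : K} {i : ℕ} (h : ‖v‖ * r ^ i < ‖u‖ * r ^ i) : ‖u - v‖ = ‖u‖ := by
      have h' : ‖v‖ < ‖u‖ := lt_of_mul_lt_mul_right h (by positivity)
      rw [IsUltrametricDist.norm_sub_eq_max_of_norm_ne_norm h'.ne', max_eq_left h'.le]
    refine ⟨upper, ?_⟩
    rcases le_or_gt ‖b‖ r with hbr | hbr
    · have hcard : ((a ::ₘ S).filter (· ∈ closedBall x₀ r)).card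
          = (S.filter (· ∈ closedBall x₀ r)).card + 1 := by
        rw [Multiset.filter_cons_of_pos _ (hb.2 hbr), Multiset.card_cons]
      rw [hcard]
      generalize (S.filter (· ∈ closedBall x₀ r)).card = k at h2 h3 ⊢
      have hRr : R = r := max_eq_left hbr
      have strict (i : ℕ) (x : ℝ) (hx : x ≤ R)
          (hi : k < i) :
          ‖p.coeff i‖ * r ^ i * x < M * R :=
        (mul_le_mul_of_nonneg_left hx (by positivity)).trans_lt
          (mul_lt_mul_of_pos_right (h2 i hi) hRpos)
      refine ⟨?_, ?_⟩
      · rintro (_ | i) hi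
        · omega
        · rw [e1]
          refine (hmax _ _ _).trans_lt (max_lt ?_ ?_)
          · rw [t1]
            exact strict i r hrR (by omega)
          · rw [t2]
            exact strict (i + 1) _ hbR (by omega)
      · have hu : ‖p.coeff k‖ * r ^ (k + 1) = M * R := by rw [t1, h3, hRr]
        rw [e1, eq_of_lt (i := k + 1), hu]
        rw [hu, t2]
        exact strict _ _ hbR (Nat.lt_succ_self _)
    · have hcard : ((a ::ₘ S).filter (· ∈ closedBall x₀ r)).card
          = (S.filter (· ∈ closedBall x₀ r)).card := by
        rw [Multiset.filter_cons_of_neg _ (fun h => hbr.not_ge (hb.1 h))]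
      rw [hcard]
      generalize (S.filter (· ∈ closedBall x₀ r)).card = k at h2 h3 ⊢
      have hRb : R = ‖b‖ := max_eq_right hbr.le
      have strict (i : ℕ) : ‖p.coeff i‖ * r ^ (i + 1) < M * R := by
        rw [t1]
        exact (mul_le_mul_of_nonneg_right (h1 i) hr.le).trans_lt
          (mul_lt_mul_of_pos_left (hRb ▸ hbr) hMpos)
      refine ⟨?_, ?_⟩
      · rintro (_ | i) hi
        · omega
        · rw [e1]
          refine (hmax _ _ _).trans_lt (max_lt (strict i) ?_)
          rw [t2, ← hRb]
          exact mul_lt_mul_of_pos_right (h2 _ hi) hRpos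
      · have hv := t2 k
        rw [h3, ← hRb] at hv
        rcases k with _ | k
        · rw [e0, norm_neg, hv]
        · rw [e1, norm_sub_rev, eq_of_lt (i := k + 1), hv]
          rw [hv]
          exact strict k

theorem norm_eval_le_splitGaussNorm {K : Type*} [NormedField K] [IsUltrametricDist K]
    {x₀ z : K} {r : ℝ} (hz : z ∈ closedBall x₀ r) (c : K) (S : Multiset K) :
    ‖(C c * (S.map fun a => X - C a).prod).eval z‖ ≤ splitGaussNorm x₀ r c S := by
  have hr : 0 ≤ r := dist_nonneg.trans hz
  rw [eval_mul, eval_C, norm_mul, splitGaussNorm]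
  refine mul_le_mul_of_nonneg_left ?_ (norm_nonneg _)
  induction S using Multiset.induction_on with
  | empty => simp
  | cons a S ih =>
    simp only [Multiset.map_cons, Multiset.prod_cons, eval_mul, norm_mul, eval_sub, eval_X, eval_C]
    refine mul_le_mul ?_ ih (norm_nonneg _) (hr.trans (le_max_left _ _))
    rw [mem_closedBall, dist_eq_norm] at hz
    calc ‖z - a‖ = ‖(z - x₀) - (a - x₀)‖ := by rw [sub_sub_sub_cancel_right]
      _ ≤ max ‖z - x₀‖ ‖a - x₀‖ := IsUltrametricDist.norm_sub_le_max_norm _ _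
      _ ≤ max r ‖a - x₀‖ := max_le_max_right _ hz

theorem norm_eval_eq_splitGaussNorm {K : Type*} [NormedField K] [IsUltrametricDist K]
    (x₀ w c : K) (S : Multiset K) (hS : ∀ a ∈ S, ‖w‖ ≠ ‖a - x₀‖) :
    ‖(C c * (S.map fun a => X - C a).prod).eval (x₀ + w)‖ = splitGaussNorm x₀ ‖w‖ c S := by
  rw [eval_mul, eval_C, norm_mul, splitGaussNorm]
  congr 1
  induction S using Multiset.induction_on with
  | empty => simp
  | cons a S ih =>
    simp only [Multiset.map_cons, Multiset.prod_cons, eval_mul, norm_mul, eval_sub, eval_X, eval_C]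
    rw [ih fun b hb => hS b (Multiset.mem_cons_of_mem hb)]
    congr 1
    rw [← IsUltrametricDist.norm_sub_eq_max_of_norm_ne_norm (hS a (Multiset.mem_cons_self a S))]
    congr 1
    ring

theorem continuous_splitGaussNorm {K : Type*} [NormedField K] (x₀ c : K) (S : Multiset K) :
    Continuous fun r => splitGaussNorm x₀ r c S :=
  continuous_const.mul (continuous_multiset_prod S fun _ _ => continuous_id.max continuous_const)

open scoped Topology in
/-- Maximum principle: the Gauss norm is the supremum of the norm on the closed disk. -/
theorem isLUB_norm_eval_splitGaussNorm {K : Type*} [NontriviallyNormedField K]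
    [IsUltrametricDist K] [IsAlgClosed K] (x₀ : K) {r : ℝ} (hr : 0 < r) (c : K)
    (S : Multiset K) :
    IsLUB ((fun z => ‖(C c * (S.map fun a => X - C a).prod).eval z‖) '' closedBall x₀ r)
      (splitGaussNorm x₀ r c S) := by
  refine ⟨?_, fun B hB => ?_⟩
  · rintro _ ⟨z, hz, rfl⟩
    exact norm_eval_le_splitGaussNorm hz c S
  have hfreq : ∃ᶠ ρ in 𝓝[<] r, ∃ w : K, ‖w‖ = ρ := by
    rw [(nhdsLT_basis_of_exists_lt ⟨0, hr⟩).frequently_iff]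
    intro l hl
    obtain ⟨w, hw1, hw2⟩ := exists_norm_mem_Ioo_of_isAlgClosed K
      (lt_max_of_lt_right (b := l) (half_pos hr)) (max_lt hl (half_lt_self hr))
    exact ⟨‖w‖, ⟨(le_max_left _ _).trans_lt hw1, hw2⟩, w, rfl⟩
  have hev : ∀ᶠ ρ in 𝓝[<] r, ∀ a ∈ S.toFinset, ρ ≠ ‖a - x₀‖ := by
    rw [Filter.eventually_all_finset]
    intro a _
    rcases lt_or_ge ‖a - x₀‖ r with h | h
    · filter_upwards [Ioo_mem_nhdsLT h] with ρ hρ using hρ.1.ne'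
    · filter_upwards [self_mem_nhdsWithin] with ρ hρ using (lt_of_lt_of_le hρ h).ne
  refine le_of_tendsto_of_frequently
    ((continuous_splitGaussNorm x₀ c S).tendsto r |>.mono_left nhdsWithin_le_nhds)
    ((hfreq.and_eventually (hev.and self_mem_nhdsWithin)).mono ?_)
  rintro _ ⟨⟨w, rfl⟩, hne, hlt⟩
  rw [← norm_eval_eq_splitGaussNorm x₀ w c S fun a ha => hne a (Multiset.mem_toFinset.2 ha)]
  refine hB ⟨x₀ + w, ?_, rfl⟩
  rw [mem_closedBall, dist_eq_norm, add_sub_cancel_left]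
  exact le_of_lt hlt

/-- Tame distortion equality: for a nonconstant polynomial `f` over an algebraically closed,
complete nonarchimedean field, with `s` the radius of the image of the closed disk `D̄(x₀,r)`
and `m` the number of solutions of `f(z) = f(x₀)` in `D̄(x₀,r)` counted with multiplicity,
if `‖(m : K)‖ = 1` then `r · sup_{D̄(x₀,r)} ‖f'‖ = s`. -/
theorem mul_sSup_norm_deriv_eq_of_tame
    {K : Type*} [NontriviallyNormedField K] [IsUltrametricDist K]
    [IsAlgClosed K] [CharZero K] [CompleteSpace K]
    (f : Polynomial K) (hf : 0 < f.natDegree) (x₀ : K) (r : ℝ) (hr : 0 < r)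
    (s : ℝ) (hs : s = sSup ((fun z => ‖f.eval z - f.eval x₀‖) '' closedBall x₀ r))
    (m : ℕ)
    (hm : m = Multiset.card
      (((f - Polynomial.C (f.eval x₀)).roots).filter (· ∈ closedBall x₀ r)))
    (htame : ‖(m : K)‖ = 1) :
    r * sSup ((fun z => ‖(Polynomial.derivative f).eval z‖) '' closedBall x₀ r) = s := by
  have hne : (closedBall x₀ r).Nonempty := nonempty_closedBall.2 hr.le
  have key (p : K[X]) :
      C p.leadingCoeff * (p.roots.map fun a => X - C a).prod = p :=
    (IsAlgClosed.splits p).eq_prod_roots.symm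
  set g := f - C (f.eval x₀) with hg
  have hgd : derivative g = derivative f := by simp [hg]
  have hd0 : derivative f ≠ 0 := fun h =>
    hf.ne' (derivative_eq_zero.1 h)
  have hg0 : g ≠ 0 := by
    rintro h
    rw [h, derivative_zero] at hgd
    exact hd0 hgd.symm
  have Lg := isLUB_norm_eval_splitGaussNorm x₀ hr g.leadingCoeff g.roots
  obtain ⟨g1, -, g3⟩ := taylor_coeff_splitGaussNorm x₀ hr (leadingCoeff_ne_zero.2 hg0) g.roots
  have Ld := isLUB_norm_eval_splitGaussNorm x₀ hr (derivative f).leadingCoeff (derivative f).roots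
  obtain ⟨d1, -, d3⟩ :=
    taylor_coeff_splitGaussNorm x₀ hr (leadingCoeff_ne_zero.2 hd0) (derivative f).roots
  rw [key] at Lg g3 Ld d3
  simp only [key] at g1 d1
  have hsg : (fun z => ‖f.eval z - f.eval x₀‖) = fun z => ‖g.eval z‖ := by
    simp [hg]
  rw [hsg, Lg.csSup_eq (hne.image _)] at hs
  rw [Ld.csSup_eq (hne.image _), hs]
  rw [← hm] at g3
  have hcoeff (i : ℕ) : (taylor x₀ (derivative f)).coeff i
      = (taylor x₀ g).coeff (i + 1) * ((i + 1 : ℕ) : K) := by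
    have : taylor x₀ (derivative f) = derivative (taylor x₀ g) := by
      simp [← hgd, taylor_apply, derivative_comp]
    rw [this, coeff_derivative]
    push_cast
    rfl
  apply le_antisymm
  · rw [← d3, hcoeff, norm_mul]
    generalize (Multiset.filter (· ∈ closedBall x₀ r) (derivative f).roots).card = k
    have h1 := g1 (k + 1)
    have h2 : ‖((k + 1 : ℕ) : K)‖ ≤ 1 := IsUltrametricDist.norm_natCast_le_one K _
    have h3 : 0 ≤ ‖(taylor x₀ g).coeff (k + 1)‖ * r ^ (k + 1) := by positivity
    calc _ = ‖(taylor x₀ g).coeff (k + 1)‖ * r ^ (k + 1) * ‖((k + 1 : ℕ) : K)‖ := by ring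
      _ ≤ ‖(taylor x₀ g).coeff (k + 1)‖ * r ^ (k + 1) := mul_le_of_le_one_right h3 h2
      _ ≤ _ := h1
  · rcases m with _ | k
    · simp at htame
    have h1 := d1 k
    rw [hcoeff, norm_mul, htame, mul_one] at h1
    rw [← g3]
    calc _ = r * (‖(taylor x₀ g).coeff (k + 1)‖ * r ^ k) := by ring
      _ ≤ _ := mul_le_mul_of_nonneg_left h1 hr.le
end

section
/- Let f ∈ K[z] be a nonconstant polynomial of degree d with leading coefficient a_d, let x₀ ∈ K and r > 0. If every root of the polynomial f − f(x₀) lies in the closed disk D̄(x₀,r), then f(D̄(x₀,r)) = D̄(f(x₀), ‖a_d‖ · r^d); equivalently, sup_{z ∈ D̄(x₀,r)} ‖f(z) − f(x₀)‖ = ‖a_d‖ · r^d. (This is the fact diam(f(ξ_f)) = |a_d| R_f^d used for the base point of a polynomial.) -/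
open Polynomial Metric

/-- The norm of a value of a split polynomial as a product of distances to the roots. -/
theorem norm_eval_eq_prod_roots {K : Type*} [NormedField K] {p : K[X]} (hp : p.Splits) (z : K) :
    ‖p.eval z‖ = ‖p.leadingCoeff‖ * (p.roots.map fun u => ‖z - u‖).prod := by
  rw [hp.eval_eq_prod_roots, norm_mul]
  congr 1
  simpa [Multiset.map_map, Function.comp_def] using
    map_multiset_prod (normHom : K →*₀ ℝ) (p.roots.map fun u => z - u)

/-- If every root of `p` is within `r` of `z`, then `‖p(z)‖ ≤ ‖a_d‖ · r^d`. -/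
theorem norm_eval_le_of_roots {K : Type*} [NormedField K] {p : K[X]} (hp : p.Splits) {z : K}
    {r : ℝ} (h : ∀ u ∈ p.roots, ‖z - u‖ ≤ r) :
    ‖p.eval z‖ ≤ ‖p.leadingCoeff‖ * r ^ p.natDegree := by
  rw [norm_eval_eq_prod_roots hp, hp.natDegree_eq_card_roots]
  refine mul_le_mul_of_nonneg_left ?_ (norm_nonneg _)
  simpa using Multiset.prod_map_le_prod_map₀ (fun u => ‖z - u‖) (fun _ => r)
    (fun _ _ => norm_nonneg _) h

/-- If `‖p(z)‖ ≤ ‖a_d‖ · r^d`, then some root of `p` is within `r` of `z`. -/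
theorem exists_root_mem_closedBall {K : Type*} [NormedField K] {p : K[X]} (hp : p.Splits)
    (hd : 0 < p.natDegree) {z : K} {r : ℝ} (hr : 0 < r)
    (h : ‖p.eval z‖ ≤ ‖p.leadingCoeff‖ * r ^ p.natDegree) :
    ∃ u ∈ closedBall z r, p.eval u = 0 := by
  have h0 : p ≠ 0 := ne_zero_of_natDegree_gt hd
  by_contra! hcon
  have hfar : ∀ u ∈ p.roots, r < ‖z - u‖ := by
    intro u hu
    by_contra! hle
    exact hcon u (by rwa [mem_closedBall, dist_comm, dist_eq_norm]) ((mem_roots h0).1 hu)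
  have hne : p.roots ≠ 0 := by
    rw [← Multiset.card_pos, ← hp.natDegree_eq_card_roots]
    exact hd
  have hlt := Multiset.prod_map_lt_prod_map hne (fun _ => r) (fun u => ‖z - u‖)
    (fun _ _ => hr) hfar
  rw [Multiset.map_const', Multiset.prod_replicate, ← hp.natDegree_eq_card_roots] at hlt
  rw [norm_eval_eq_prod_roots hp] at h
  exact absurd (mul_lt_mul_of_pos_left hlt (norm_pos_iff.2 (leadingCoeff_ne_zero.2 h0))) h.not_gt

/-- The value group of a nontrivially normed algebraically closed field is dense. -/
theorem exists_lt_norm_le_of_isAlgClosed (K : Type*) [NontriviallyNormedField K] [IsAlgClosed K]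
    {t R : ℝ} (hR : 0 < R) (ht : t < R) : ∃ w : K, t < ‖w‖ ∧ ‖w‖ ≤ R := by
  rcases le_or_gt t 0 with ht0 | ht0
  · obtain ⟨w, hw, hwR⟩ := NormedField.exists_norm_lt K hR
    exact ⟨w, ht0.trans_lt hw, hwR.le⟩
  obtain ⟨c, hc⟩ := NormedField.exists_one_lt_norm K
  obtain ⟨n, hn⟩ := pow_unbounded_of_one_lt ‖c‖ ((one_lt_div ht0).2 ht)
  have hn0 : n ≠ 0 := by
    rintro rfl
    rw [pow_zero] at hn
    exact hn.not_gt hc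
  obtain ⟨b, rfl⟩ := IsAlgClosed.exists_pow_nat_eq c (Nat.pos_of_ne_zero hn0)
  rw [norm_pow] at hc hn
  have hb1 : 1 < ‖b‖ := (one_lt_pow_iff_of_nonneg (norm_nonneg b) hn0).1 hc
  have hb2 : ‖b‖ < R / t := lt_of_pow_lt_pow_left₀ n (by positivity) hn
  obtain ⟨k, hk1, hk2⟩ := exists_mem_Ico_zpow hR hb1
  have hb0 : 0 < ‖b‖ := one_pos.trans hb1
  refine ⟨b ^ k, ?_, by rwa [norm_zpow]⟩
  rw [norm_zpow]
  rw [zpow_add_one₀ hb0.ne'] at hk2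
  rw [lt_div_iff₀ ht0, mul_comm] at hb2
  exact lt_of_mul_lt_mul_right (hb2.trans hk2) hb0.le

/-- If all roots of `f − f(x₀)` lie in the closed disk `D̄(x₀,r)`, then `f` maps `D̄(x₀,r)`
onto the closed disk of radius `‖a_d‖ · r^d` around `f(x₀)`, where `a_d` is the leading
coefficient and `d` the degree of `f`; equivalently
`sup_{z ∈ D̄(x₀,r)} ‖f(z) − f(x₀)‖ = ‖a_d‖ · r^d`. -/
theorem image_closedBall_of_roots_mem
    {K : Type*} [NontriviallyNormedField K] [IsUltrametricDist K]
    [IsAlgClosed K] [CharZero K] [CompleteSpace K]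
    (f : Polynomial K) (hf : 0 < f.natDegree) (x₀ : K) (r : ℝ) (hr : 0 < r)
    (hroots : ∀ z : K, (f - Polynomial.C (f.eval x₀)).eval z = 0 → z ∈ closedBall x₀ r) :
    (fun z => f.eval z) '' closedBall x₀ r =
        closedBall (f.eval x₀) (‖f.leadingCoeff‖ * r ^ f.natDegree) ∧
      sSup ((fun z => ‖f.eval z - f.eval x₀‖) '' closedBall x₀ r) =
        ‖f.leadingCoeff‖ * r ^ f.natDegree := by
  have hlc (c : K) : (f - C c).leadingCoeff = f.leadingCoeff := by
    apply leadingCoeff_sub_of_degree_lt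
    exact degree_C_le.trans_lt (natDegree_pos_iff_degree_pos.1 hf)
  have hlc0 : 0 < ‖f.leadingCoeff‖ :=
    norm_pos_iff.2 (leadingCoeff_ne_zero.2 (ne_zero_of_natDegree_gt hf))
  have himage : (fun z => f.eval z) '' closedBall x₀ r =
      closedBall (f.eval x₀) (‖f.leadingCoeff‖ * r ^ f.natDegree) := by
    apply Set.Subset.antisymm
    · rintro _ ⟨z, hz, rfl⟩
      have h := norm_eval_le_of_roots (p := f - C (f.eval x₀)) (z := z) (r := r)
        (IsAlgClosed.splits _) fun u hu => by
          have hu' := hroots u (isRoot_of_mem_roots hu)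
          rw [← dist_eq_norm]
          exact (dist_triangle_max z x₀ u).trans (max_le hz (mem_closedBall'.1 hu'))
      rwa [hlc, natDegree_sub_C, eval_sub, eval_C, ← dist_eq_norm] at h
    · intro w hw
      obtain ⟨u, hu, hu0⟩ := exists_root_mem_closedBall (p := f - C w) (z := x₀)
        (IsAlgClosed.splits _) (by rwa [natDegree_sub_C]) hr (by
          rwa [hlc, natDegree_sub_C, eval_sub, eval_C, ← dist_eq_norm, ← mem_closedBall'])
      exact ⟨u, hu, by simpa [sub_eq_zero] using hu0⟩
  refine ⟨himage, IsLUB.csSup_eq ⟨?_, ?_⟩ ((nonempty_closedBall.2 hr.le).image _)⟩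
  · rintro _ ⟨z, hz, rfl⟩
    beta_reduce
    rw [← dist_eq_norm, ← mem_closedBall, ← himage]
    exact ⟨z, hz, rfl⟩
  · intro t ht
    by_contra! hlt
    obtain ⟨w, hw, hwR⟩ := exists_lt_norm_le_of_isAlgClosed K (by positivity) hlt
    have hmem : f.eval x₀ + w ∈ (fun z => f.eval z) '' closedBall x₀ r := by
      simpa [himage] using hwR
    obtain ⟨z, hz, hzw⟩ := hmem
    refine hw.not_ge (ht ⟨z, hz, ?_⟩)
    simp only at hzw
    simp [hzw]
end
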